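/- If n is even and p = 2, then R(n,2)^2 ⊆ (Y_3 ∩ T) + Y_4. -/

import Mathlib

open scoped Classical

set_option synthInstance.maxHeartbeats 1000000
set_option maxHeartbeats 1000000

noncomputable section

/-- The group algebra `F_p[S_n]`. -/
abbrev GroupAlg (n p : ℕ) : Type := MonoidAlgebra (ZMod p) (Equiv.Perm (Fin n))

/-- The descent set of a permutation `σ` of `{1,…,n}` (1-based positions):
`k ∈ {1,…,n-1}` is a descent if `σ(k) > σ(k+1)`.  (With 0-based `Fin n` indices this
compares the images at indices `k-1` and `k`.) -/
def descSet {n : ℕ} (σ : Equiv.Perm (Fin n)) : Set ℕ :=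
  {k | ∃ h : k < n, 0 < k ∧ σ ⟨k, h⟩ < σ ⟨k - 1, by omega⟩}

/-- The set of proper partial sums `{a_1, a_1+a_2, …, a_1+⋯+a_{s-1}}` of a composition. -/
def properPartialSums {n : ℕ} (q : Composition n) : Set ℕ :=
  {m | ∃ i : ℕ, 0 < i ∧ i < q.length ∧ m = q.sizeUpTo i}

/-- `B̄_q`: the sum of all permutations whose descent set is contained in the set of
proper partial sums of `q`. -/
def Bel (n p : ℕ) (q : Composition n) : GroupAlg n p :=
  ∑ σ ∈ Finset.univ.filter
      (fun σ : Equiv.Perm (Fin n) => descSet σ ⊆ properPartialSums q),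
    MonoidAlgebra.of (ZMod p) (Equiv.Perm (Fin n)) σ

/-- The p-modular descent algebra `Σ(n,p)`, as a subalgebra of the group algebra. -/
def descentAlgebra (n p : ℕ) : Subalgebra (ZMod p) (GroupAlg n p) :=
  Algebra.adjoin (ZMod p) (Set.range (Bel n p))

/-- `B̄_q` as an element of `Σ(n,p)`. -/
def BelS (n p : ℕ) (q : Composition n) : descentAlgebra n p :=
  ⟨Bel n p q, Algebra.subset_adjoin ⟨q, rfl⟩⟩

/-- The Jacobson radical `R(n,p)` of `Σ(n,p)`. -/
def descentRadical (n p : ℕ) : Ideal (descentAlgebra n p) :=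
  (⊥ : Ideal (descentAlgebra n p)).jacobson

/-- `R(n,p)` viewed as an `F_p`-subspace of the group algebra. -/
def descentRadicalSubmodule (n p : ℕ) : Submodule (ZMod p) (GroupAlg n p) :=
  Submodule.map (descentAlgebra n p).val.toLinearMap
    ((descentRadical n p).restrictScalars (ZMod p))

/-- `Y_m`: the span of the `B̄_q` with `q` having at least `m` components. -/
def Ysub (n p m : ℕ) : Submodule (ZMod p) (GroupAlg n p) :=
  Submodule.span (ZMod p) {x | ∃ q : Composition n, m ≤ q.length ∧ x = Bel n p q}

/-- `T`: the span of all differences `B̄_q - B̄_r` with `q ≈ r`. -/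
def Tsub (n p : ℕ) : Submodule (ZMod p) (GroupAlg n p) :=
  Submodule.span (ZMod p)
    {x | ∃ q r : Composition n, q.blocks.Perm r.blocks ∧ x = Bel n p q - Bel n p r}

/-- `g(n,p)`: the number of partitions of `n` with no part divisible by `p`. -/
def gPart (n p : ℕ) : ℕ := Set.ncard {π : n.Partition | ∀ i ∈ π.parts, ¬ p ∣ i}

/-- `g(n,p)`: the number of conjugacy classes of `p`-regular elements of `S_n`. -/
def gReg (n p : ℕ) : ℕ :=
  Set.ncard {c : ConjClasses (Equiv.Perm (Fin n)) | ∀ σ ∈ c.carrier, (orderOf σ).Coprime p}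

/-- The Young character `χ_q`: `χ_q(σ)` is the number of ordered set partitions
`(P_1,…,P_s)` of `{1,…,n}` with `|P_i| = a_i`, each of whose blocks is `σ`-invariant. -/
def youngChar {n : ℕ} (q : Composition n) (σ : Equiv.Perm (Fin n)) : ℕ :=
  (Finset.univ.filter (fun P : Fin q.length → Finset (Fin n) =>
    (∀ i, (P i).card = q.blocksFun i) ∧
    (∀ i j, i ≠ j → Disjoint (P i) (P j)) ∧
    (∀ x, ∃ i, x ∈ P i) ∧
    (∀ i, ∀ x ∈ P i, σ x ∈ P i))).card

/-- `χ̃_q`: the Young character with values reduced mod `p`. -/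
def youngCharMod (n p : ℕ) (q : Composition n) : Equiv.Perm (Fin n) → ZMod p :=
  fun σ => (youngChar q σ : ZMod p)

/-- `G(n,p)`: the span of the mod-`p` Young characters. -/
def Gnp (n p : ℕ) : Submodule (ZMod p) (Equiv.Perm (Fin n) → ZMod p) :=
  Submodule.span (ZMod p) (Set.range (youngCharMod n p))

/-- `S(q,r)`: matrices with row sums `q` and column sums `r`. -/
def SMat {n : ℕ} (q r : Composition n) : Set (Matrix (Fin q.length) (Fin r.length) ℕ) :=
  {Z | (∀ i, ∑ j, Z i j = q.blocksFun i) ∧ (∀ j, ∑ i, Z i j = r.blocksFun j)}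

/-- `w(Z)`: the list of nonzero entries of `Z` read row by row. -/
def wList {s t : ℕ} (Z : Matrix (Fin s) (Fin t) ℕ) : List ℕ :=
  ((List.finRange s).flatMap fun i => ((List.finRange t).map fun j => Z i j)).filter
    (fun x => x ≠ 0)

/-- One merging step: replace two adjacent components by their sum. -/
def mergeStep (l l' : List ℕ) : Prop :=
  ∃ (u v : List ℕ) (a b : ℕ), l = u ++ a :: b :: v ∧ l' = u ++ (a + b) :: v

/-- `coarsens l l'` (`l ⪯ l'` on compositions): `l'` is obtained from `l` by repeatedly
replacing adjacent components by their sum. -/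
def coarsens (l l' : List ℕ) : Prop := Relation.ReflTransGen mergeStep l l'

/-- The strict descents of an arbitrary word `K`. -/
def wordDes {n : ℕ} (K : Fin n → Fin n) : Set ℕ :=
  {k | ∃ h : k < n, 0 < k ∧ K ⟨k, h⟩ < K ⟨k - 1, by omega⟩}

/-- The positions at which the word `K` changes its value. -/
def cut {n : ℕ} (K : Fin n → Fin n) : Finset ℕ :=
  (Finset.range n).filter fun k => ∃ h : k < n, 0 < k ∧ K ⟨k, h⟩ ≠ K ⟨k - 1, by omega⟩

/-- The sum of all permutations whose descent set is contained in `S`. -/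
def descSum (n p : ℕ) (S : Finset ℕ) : GroupAlg n p :=
  ∑ σ ∈ Finset.univ.filter (fun σ : Equiv.Perm (Fin n) => descSet σ ⊆ (S : Set ℕ)),
    MonoidAlgebra.of (ZMod p) (Equiv.Perm (Fin n)) σ

theorem mem_cut {n : ℕ} {K : Fin n → Fin n} {k : ℕ} :
    k ∈ cut K ↔ ∃ h : k < n, 0 < k ∧ K ⟨k, h⟩ ≠ K ⟨k - 1, by omega⟩ := by
  simp only [cut, Finset.mem_filter, Finset.mem_range, and_iff_right_iff_imp]
  exact fun ⟨h, _⟩ => h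

theorem mem_wordDes {n : ℕ} {K : Fin n → Fin n} {k : ℕ} :
    k ∈ wordDes K ↔ ∃ h : k < n, 0 < k ∧ K ⟨k, h⟩ < K ⟨k - 1, by omega⟩ := Iff.rfl

theorem wordDes_subset_cut {n : ℕ} (K : Fin n → Fin n) : wordDes K ⊆ (cut K : Set ℕ) := by
  rintro k ⟨h, h0, hk⟩
  exact mem_cut.2 ⟨h, h0, hk.ne⟩

theorem cut_subset_Ico {n : ℕ} (K : Fin n → Fin n) : cut K ⊆ Finset.Ico 1 n := by
  intro k hk
  obtain ⟨h, h0, -⟩ := mem_cut.1 hk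
  exact Finset.mem_Ico.2 ⟨h0, h⟩

/-- A function compared along consecutive positions can be compared along an interval. -/
theorem rel_of_forall_consecutive {n : ℕ} {α : Type*} (r : α → α → Prop)
    (hr : ∀ a b c, r a b → r b c → r a c)
    (f : Fin n → α) {i j : Fin n} (hij : i < j)
    (h : ∀ k (hk : k < n), (i : ℕ) < k → k ≤ j → r (f ⟨k - 1, by omega⟩) (f ⟨k, hk⟩)) :
    r (f i) (f j) := by
  obtain ⟨j, hj⟩ := j
  induction j with
  | zero => exact absurd hij (by simp [Fin.lt_def])
  | succ j ih =>
    have hij' : (i : ℕ) < j + 1 := hij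
    have hlast := h (j + 1) hj hij' le_rfl
    rcases Nat.lt_succ_iff_lt_or_eq.1 hij' with hlt | heq
    · exact hr _ _ _ (ih (by omega) hlt fun k hk h1 h2 => h k hk h1 (by simp at h2 ⊢; omega)) hlast
    · have : i = ⟨j, by omega⟩ := Fin.ext heq
      rw [this]
      exact hlast

theorem monotone_of_wordDes_subset_empty {n : ℕ} {K : Fin n → Fin n} (h : wordDes K ⊆ ∅) :
    Monotone K := by
  intro i j hij
  rcases hij.lt_or_eq with hij | rfl
  · refine rel_of_forall_consecutive (· ≤ ·) (fun _ _ _ => le_trans) K hij fun k hk h1 _ => ?_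
    by_contra hlt
    exact h ⟨hk, by omega, not_le.1 hlt⟩
  · exact le_rfl

theorem lt_of_eq_of_descSet_subset_cut {n : ℕ} {G : Fin n → Fin n} (hG : Monotone G)
    {σ : Equiv.Perm (Fin n)} (hσ : descSet σ ⊆ (cut G : Set ℕ)) {i j : Fin n} (hij : i < j)
    (h : G i = G j) : σ i < σ j := by
  refine rel_of_forall_consecutive (· < ·) (fun _ _ _ => lt_trans) σ hij fun k hk h1 h2 => ?_
  by_contra hlt
  have hne : (⟨k - 1, by omega⟩ : Fin n) ≠ ⟨k, hk⟩ := by simp [Fin.ext_iff]; omega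
  have hd : k ∈ descSet σ :=
    ⟨hk, by omega, lt_of_le_of_ne (not_lt.1 hlt) fun he => hne (σ.injective he).symm⟩
  obtain ⟨_, _, hc⟩ := mem_cut.1 (hσ hd)
  apply hc
  apply le_antisymm
  · calc G ⟨k, hk⟩ ≤ G j := hG (by simpa [Fin.le_def] using h2)
      _ = G i := h.symm
      _ ≤ _ := hG (by simp only [Fin.le_def]; omega)
  · exact hG (by simp only [Fin.le_def]; omega)

theorem descSum_cut_mul (n p : ℕ) {G : Fin n → Fin n} (hG : Monotone G) (S : Finset ℕ) :
    descSum n p (cut G) * descSum n p S =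
      ∑ K ∈ Finset.univ.filter (fun K : Fin n → Fin n =>
        (∃ π : Equiv.Perm (Fin n), K = G ∘ π) ∧ wordDes K ⊆ (S : Set ℕ)),
        descSum n p (S ∪ cut K) := by
  unfold descSum
  rw [Finset.sum_mul_sum, ← Finset.sum_product', Finset.sum_sigma']
  refine Finset.sum_bij' (fun a _ => (⟨G ∘ a.2, a.1 * a.2⟩ :
      (_ : Fin n → Fin n) × Equiv.Perm (Fin n)))
    (fun b _ => (Tuple.sort (b.1 ∘ b.2.symm), (Tuple.sort (b.1 ∘ b.2.symm))⁻¹ * b.2))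
    ?_ ?_ ?_ ?_ ?_
  · rintro ⟨σ, τ⟩ ha
    simp only [Finset.mem_product, Finset.mem_filter, Finset.mem_univ, true_and] at ha
    obtain ⟨hσ, hτ⟩ := ha
    simp only [Finset.mem_sigma, Finset.mem_filter, Finset.mem_univ, true_and]
    refine ⟨⟨⟨τ, rfl⟩, ?_⟩, ?_⟩
    · rintro k ⟨hk, h0, hlt⟩
      exact hτ ⟨hk, h0, hG.reflect_lt hlt⟩
    · rintro k ⟨hk, h0, hlt⟩
      by_contra hn
      rw [Finset.mem_coe, Finset.mem_union, not_or] at hn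
      have hlt' : τ ⟨k - 1, by omega⟩ < τ ⟨k, hk⟩ := by
        by_contra hge
        refine hn.1 (hτ ⟨hk, h0, lt_of_le_of_ne (not_lt.1 hge) fun he => ?_⟩)
        have := congrArg Fin.val (τ.injective he)
        simp only at this
        omega
      have heq : G (τ ⟨k - 1, by omega⟩) = G (τ ⟨k, hk⟩) := by
        by_contra hne
        exact hn.2 (mem_cut.2 ⟨hk, h0, fun h => hne h.symm⟩)
      exact lt_asymm hlt (lt_of_eq_of_descSet_subset_cut hG hσ hlt' heq)
  · rintro ⟨K, ρ⟩ hb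
    simp only [Finset.mem_sigma, Finset.mem_filter, Finset.mem_univ, true_and] at hb
    obtain ⟨⟨⟨π, hπ⟩, hK⟩, hρ⟩ := hb
    simp only [Finset.mem_product, Finset.mem_filter, Finset.mem_univ, true_and]
    set σ := Tuple.sort (K ∘ ρ.symm) with hσ
    have hs := Tuple.eq_sort_iff.1 hσ
    have hGσ : (K ∘ ρ.symm) ∘ σ = G := by
      have h1 : (K ∘ ρ.symm) ∘ (π.symm.trans ρ : Equiv.Perm (Fin n)) = G := by
        funext i; simp [hπ]
      rw [← h1]
      exact (Tuple.comp_sort_eq_comp_iff_monotone.2 (by rw [h1]; exact hG)).symm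
    have hGσ' : ∀ i, K (ρ.symm (σ i)) = G i := fun i => congrFun hGσ i
    have hinc : ∀ i j, i < j → G i = G j → σ i < σ j := fun i j hij he =>
      hs.2 i j hij (by simpa [hGσ'] using he)
    have hGτ : ∀ i, G (σ.symm (ρ i)) = K i := fun i => by rw [← hGσ']; simp
    constructor
    · rintro k ⟨hk, h0, hlt⟩
      refine mem_cut.2 ⟨hk, h0, fun he => ?_⟩
      exact lt_asymm hlt (hinc _ _ (by simp only [Fin.lt_def]; omega) he.symm)
    · rintro k ⟨hk, h0, hlt⟩
      by_contra hkS
      have hle : K ⟨k - 1, by omega⟩ ≤ K ⟨k, hk⟩ := by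
        by_contra hn
        exact hkS (hK ⟨hk, h0, not_le.1 hn⟩)
      change σ.symm (ρ _) < σ.symm (ρ _) at hlt
      have hKe : K ⟨k, hk⟩ = K ⟨k - 1, by omega⟩ := by
        refine le_antisymm ?_ hle
        rw [← hGτ, ← hGτ]
        exact hG hlt.le
      have := hinc _ _ hlt (by rw [hGτ, hGτ, hKe])
      simp only [Equiv.apply_symm_apply] at this
      have hm := hρ ⟨hk, h0, this⟩
      rw [Finset.mem_coe, Finset.mem_union] at hm
      rcases hm with hm | hm
      · exact hkS hm
      · obtain ⟨_, _, hc⟩ := mem_cut.1 hm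
        exact hc hKe
  · rintro ⟨σ, τ⟩ ha
    simp only [Finset.mem_product, Finset.mem_filter, Finset.mem_univ, true_and] at ha
    have hσ : σ = Tuple.sort ((G ∘ τ) ∘ (σ * τ).symm) := by
      have hc : ∀ i, ((G ∘ τ) ∘ (σ * τ).symm) (σ i) = G i := fun i => by
        simp [Equiv.Perm.mul_def]
      refine Tuple.eq_sort_iff.2 ⟨?_, fun i j hij he => ?_⟩
      · intro i j hij
        exact (hc i).trans_le ((hG hij).trans_eq (hc j).symm)
      · rw [hc, hc] at he
        exact lt_of_eq_of_descSet_subset_cut hG ha.1 hij he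
    simp only
    rw [← hσ]
    simp
  · rintro ⟨K, ρ⟩ hb
    simp only [Finset.mem_sigma, Finset.mem_filter, Finset.mem_univ, true_and] at hb
    obtain ⟨⟨⟨π, hπ⟩, hK⟩, hρ⟩ := hb
    have hGσ : (K ∘ ρ.symm) ∘ Tuple.sort (K ∘ ρ.symm) = G := by
      have h1 : (K ∘ ρ.symm) ∘ (π.symm.trans ρ : Equiv.Perm (Fin n)) = G := by
        funext i; simp [hπ]
      rw [← h1]
      exact (Tuple.comp_sort_eq_comp_iff_monotone.2 (by rw [h1]; exact hG)).symm
    have hGσ' : ∀ i, K (ρ.symm (Tuple.sort (K ∘ ρ.symm) i)) = G i := fun i => congrFun hGσ i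
    simp only [Sigma.mk.injEq, mul_inv_cancel_left, heq_eq_eq, and_true]
    funext i
    simp [← hGσ']
  · rintro ⟨σ, τ⟩ ha
    simp

/-- The proper partial sums of a composition, as a finset. -/
def breaks {n : ℕ} (q : Composition n) : Finset ℕ :=
  (Finset.Ioo 0 q.length).image q.sizeUpTo

theorem coe_breaks {n : ℕ} (q : Composition n) : (breaks q : Set ℕ) = properPartialSums q := by
  ext k
  simp only [breaks, Finset.coe_image, Finset.coe_Ioo, Set.mem_image, Set.mem_Ioo,
    properPartialSums, Set.mem_ofPred_eq, and_assoc]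
  exact exists_congr fun i => and_congr_right fun _ => and_congr_right fun _ => eq_comm

theorem Bel_eq_descSum {n : ℕ} (p : ℕ) (q : Composition n) :
    Bel n p q = descSum n p (breaks q) := by
  simp only [Bel, descSum, coe_breaks]

theorem sizeUpTo_strictMonoOn {n : ℕ} (q : Composition n) :
    StrictMonoOn q.sizeUpTo (Set.Iic q.length) := by
  intro i _ j hj hij
  have := q.boundary.strictMono (a := ⟨i, by simp at hj; omega⟩) (b := ⟨j, by simp at hj; omega⟩)
    (by simpa [Fin.lt_def] using hij)
  simpa [Composition.boundary, Fin.lt_def] using this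

theorem breaks_subset_Ico {n : ℕ} (q : Composition n) : breaks q ⊆ Finset.Ico 1 n := by
  intro k hk
  simp only [breaks, Finset.mem_image, Finset.mem_Ioo] at hk
  obtain ⟨i, ⟨h0, h1⟩, rfl⟩ := hk
  have hmono := sizeUpTo_strictMonoOn q
  have ha := hmono (a := 0) (b := i) (by simp) (by simp; omega) h0
  have hb := hmono (a := i) (b := q.length) (by simp; omega) (by simp) h1
  simp only [Composition.sizeUpTo_zero, Composition.sizeUpTo_length] at ha hb
  exact Finset.mem_Ico.2 ⟨ha, hb⟩

theorem card_breaks {n : ℕ} (q : Composition n) : (breaks q).card = q.length - 1 := by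
  rw [breaks, Finset.card_image_of_injOn, Nat.card_Ioo]
  · omega
  · intro i hi j hj h
    simp only [Finset.coe_Ioo, Set.mem_Ioo] at hi hj
    exact (sizeUpTo_strictMonoOn q).injOn (by simp; omega) (by simp; omega) h

theorem exists_breaks_eq {n : ℕ} {S : Finset ℕ} (hS : S ⊆ Finset.Ico 1 n) :
    ∃ q : Composition n, breaks q = S := by
  let c : CompositionAsSet n :=
    { boundaries := Finset.univ.filter fun i => i = 0 ∨ i = Fin.last n ∨ (i : ℕ) ∈ S
      zero_mem := by simp
      getLast_mem := by simp }
  refine ⟨c.toComposition, ?_⟩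
  have hc : ∀ j : Fin (n + 1), (∃ i, c.toComposition.boundary i = j) ↔
      j = 0 ∨ j = Fin.last n ∨ (j : ℕ) ∈ S := fun j => by
    have := congrArg (j ∈ ·) c.toComposition_boundaries
    simpa [Composition.boundaries, c] using this
  have hsub := breaks_subset_Ico c.toComposition
  ext k
  constructor
  · intro hk
    have hkn := Finset.mem_Ico.1 (hsub hk)
    simp only [breaks, Finset.mem_image, Finset.mem_Ioo] at hk
    obtain ⟨i, ⟨h0, h1⟩, rfl⟩ := hk
    have := (hc ⟨c.toComposition.sizeUpTo i, by omega⟩).1 ⟨⟨i, by omega⟩, rfl⟩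
    simp only [Fin.ext_iff, Fin.val_zero, Fin.val_last] at this
    rcases this with h | h | h
    · omega
    · omega
    · exact h
  · intro hk
    have hkn := Finset.mem_Ico.1 (hS hk)
    obtain ⟨i, hi⟩ := (hc ⟨k, by omega⟩).2 (Or.inr (Or.inr hk))
    have hi' : c.toComposition.sizeUpTo i = k := congrArg Fin.val hi
    simp only [breaks, Finset.mem_image, Finset.mem_Ioo]
    refine ⟨i, ⟨?_, ?_⟩, hi'⟩
    · rcases Nat.eq_zero_or_pos (i : ℕ) with h | h
      · rw [h, Composition.sizeUpTo_zero] at hi'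
        omega
      · exact h
    · refine lt_of_le_of_ne (Nat.lt_succ_iff.1 i.2) fun h => ?_
      rw [h, Composition.sizeUpTo_length] at hi'
      omega

theorem descSum_mem_Ysub {n : ℕ} (p : ℕ) {S : Finset ℕ} {m : ℕ}
    (hS : S ⊆ Finset.Ico 1 n) (hn : 1 ≤ n) (hm : m ≤ S.card + 1) : descSum n p S ∈ Ysub n p m := by
  obtain ⟨q, rfl⟩ := exists_breaks_eq hS
  refine Submodule.subset_span ⟨q, ?_, (Bel_eq_descSum p q).symm⟩
  have := q.length_pos_of_pos hn
  rw [card_breaks] at hm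
  omega

theorem exists_monotone_cut_eq {n : ℕ} {S : Finset ℕ} (hS : S ⊆ Finset.Ico 1 n) :
    ∃ G : Fin n → Fin n, Monotone G ∧ cut G = S := by
  have hlt : ∀ i : Fin n, (S.filter (· ≤ (i : ℕ))).card < n := fun i => by
    have h : S.filter (· ≤ (i : ℕ)) ⊆ Finset.Ico 1 (i + 1) := fun k hk => by
      obtain ⟨h1, h2⟩ := Finset.mem_filter.1 hk
      have := Finset.mem_Ico.1 (hS h1)
      exact Finset.mem_Ico.2 ⟨this.1, by omega⟩
    have := Finset.card_le_card h
    rw [Nat.card_Ico] at this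
    omega
  refine ⟨fun i => ⟨_, hlt i⟩, fun i j hij => ?_, ?_⟩
  · refine Finset.card_le_card fun k hk => ?_
    have hij' : (i : ℕ) ≤ j := hij
    rw [Finset.mem_filter] at hk ⊢
    exact ⟨hk.1, hk.2.trans hij'⟩
  · ext k
    rw [mem_cut]
    constructor
    · rintro ⟨hk, h0, hne⟩
      by_contra hkS
      apply hne
      simp only [Fin.mk.injEq]
      congr 1
      refine Finset.filter_congr fun l hl => ?_
      have : l ≠ k := fun h => hkS (h ▸ hl)
      omega
    · intro hk
      have hkn := Finset.mem_Ico.1 (hS hk)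
      refine ⟨hkn.2, hkn.1, fun h => ?_⟩
      simp only [Fin.mk.injEq] at h
      refine h.not_gt (Finset.card_lt_card ?_)
      rw [Finset.ssubset_iff_of_subset]
      · exact ⟨k, by simpa using hk, by simp; omega⟩
      · intro l hl
        rw [Finset.mem_filter] at hl ⊢
        exact ⟨hl.1, by omega⟩

theorem descSum_empty (n p : ℕ) : descSum n p ∅ = 1 := by
  have h : (Finset.univ.filter fun σ : Equiv.Perm (Fin n) => descSet σ ⊆ ((∅ : Finset ℕ) : Set ℕ))
      = {1} := by
    ext σ
    simp only [Finset.coe_empty, Finset.mem_filter, Finset.mem_univ, true_and,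
      Finset.mem_singleton]
    constructor
    · intro h
      exact (Equiv.Perm.monotone_iff σ).1 (monotone_of_wordDes_subset_empty h)
    · rintro rfl k ⟨hk, h0, hlt⟩
      simp only [Equiv.Perm.one_apply, Fin.mk_lt_mk] at hlt
      omega
  rw [descSum, h, Finset.sum_singleton, map_one]

/-- The span of all `descSum n p S`. -/
def descSpan (n p : ℕ) : Submodule (ZMod p) (GroupAlg n p) :=
  Submodule.span (ZMod p) {x | ∃ S : Finset ℕ, S ⊆ Finset.Ico 1 n ∧ x = descSum n p S}

theorem descSum_mul_descSum_mem {n p : ℕ} {M : Submodule (ZMod p) (GroupAlg n p)}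
    {S R : Finset ℕ} (hS : S ⊆ Finset.Ico 1 n) (hR : R ⊆ Finset.Ico 1 n)
    (hM : ∀ Q ⊆ Finset.Ico 1 n, R ⊆ Q → descSum n p Q ∈ M) :
    descSum n p S * descSum n p R ∈ M := by
  obtain ⟨G, hG, rfl⟩ := exists_monotone_cut_eq hS
  rw [descSum_cut_mul n p hG]
  exact Submodule.sum_mem _ fun K _ =>
    hM _ (Finset.union_subset hR (cut_subset_Ico K)) Finset.subset_union_left

theorem descentAlgebra_le_descSpan (n p : ℕ) {x : GroupAlg n p} (hx : x ∈ descentAlgebra n p) :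
    x ∈ descSpan n p := by
  induction hx using Algebra.adjoin_induction with
  | mem x hx =>
    obtain ⟨q, rfl⟩ := hx
    exact Submodule.subset_span ⟨_, breaks_subset_Ico q, Bel_eq_descSum p q⟩
  | algebraMap r =>
    rw [Algebra.algebraMap_eq_smul_one, ← descSum_empty]
    exact Submodule.smul_mem _ _ (Submodule.subset_span ⟨∅, by simp, rfl⟩)
  | add x y _ _ hx hy => exact Submodule.add_mem _ hx hy
  | mul x y hx' hy' hx hy =>
    clear hx' hy'
    induction hx, hy using Submodule.span_induction₂ with
    | mem_mem a b ha hb =>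
      obtain ⟨S, hS, rfl⟩ := ha
      obtain ⟨R, hR, rfl⟩ := hb
      exact descSum_mul_descSum_mem hS hR fun Q hQ _ => Submodule.subset_span ⟨Q, hQ, rfl⟩
    | zero_left y _ => simp
    | zero_right x _ => simp
    | add_left x y z _ _ _ h1 h2 => rw [add_mul]; exact Submodule.add_mem _ h1 h2
    | add_right x y z _ _ _ h1 h2 => rw [mul_add]; exact Submodule.add_mem _ h1 h2
    | smul_left r x y _ _ h => rw [smul_mul_assoc]; exact Submodule.smul_mem _ _ h
    | smul_right r x y _ _ h => rw [mul_smul_comm]; exact Submodule.smul_mem _ _ h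

/-- Left multiplication by an element of the descent algebra is given by an `S_n`-invariant weight
on words. -/
theorem exists_weight {n p : ℕ} {x : GroupAlg n p} (hx : x ∈ descentAlgebra n p) :
    ∃ X : (Fin n → Fin n) → ZMod p, (∀ K (π : Equiv.Perm (Fin n)), X (K ∘ π) = X K) ∧
      ∀ S : Finset ℕ, x * descSum n p S =
        ∑ K ∈ Finset.univ.filter (fun K : Fin n → Fin n => wordDes K ⊆ (S : Set ℕ)),
          X K • descSum n p (S ∪ cut K) := by
  have hx' := descentAlgebra_le_descSpan n p hx
  clear hx
  rw [descSpan] at hx'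
  induction hx' using Submodule.span_induction with
  | mem x h =>
    obtain ⟨R, hR, rfl⟩ := h
    obtain ⟨G, hG, rfl⟩ := exists_monotone_cut_eq hR
    refine ⟨fun K => if ∃ π : Equiv.Perm (Fin n), K = G ∘ π then 1 else 0, fun K π => ?_,
      fun S => ?_⟩
    · refine if_congr ⟨?_, ?_⟩ rfl rfl
      · rintro ⟨ρ, h⟩
        refine ⟨π.symm.trans ρ, ?_⟩
        funext i
        simpa using congrFun h (π.symm i)
      · rintro ⟨ρ, rfl⟩
        exact ⟨π.trans ρ, rfl⟩
    · rw [descSum_cut_mul n p hG, Finset.filter_and, Finset.filter_inter, Finset.sum_filter]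
      · simp [ite_smul]
  | zero => exact ⟨0, by simp, by simp⟩
  | add x y _ _ hx hy =>
    obtain ⟨X, hX, hX'⟩ := hx
    obtain ⟨Y, hY, hY'⟩ := hy
    refine ⟨X + Y, by simp [hX, hY], fun S => ?_⟩
    rw [add_mul, hX', hY', ← Finset.sum_add_distrib]
    simp [add_smul]
  | smul r x _ hx =>
    obtain ⟨X, hX, hX'⟩ := hx
    refine ⟨r • X, by simp [hX], fun S => ?_⟩
    rw [smul_mul_assoc, hX', Finset.smul_sum]
    simp [mul_smul]

theorem exists_descSet_eq {n : ℕ} {S : Finset ℕ} (hS : S ⊆ Finset.Ico 1 n) :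
    ∃ σ : Equiv.Perm (Fin n), descSet σ = S := by
  obtain ⟨G, hG, rfl⟩ := exists_monotone_cut_eq hS
  set τ := Tuple.sort (OrderDual.toDual ∘ G) with hτ
  obtain ⟨hmono, hties⟩ := Tuple.eq_sort_iff.1 hτ
  have hpred : ∀ k (hk : k < n), (⟨k - 1, by omega⟩ : Fin n) ≤ ⟨k, hk⟩ := fun k hk => by
    simp only [Fin.mk_le_mk]; omega
  refine ⟨τ.symm, ?_⟩
  ext k
  constructor
  · rintro ⟨hk, h0, hlt⟩
    refine mem_cut.2 ⟨hk, h0, fun he => ?_⟩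
    have := hties _ _ hlt (by simp [he])
    simp only [Equiv.apply_symm_apply, Fin.mk_lt_mk] at this
    omega
  · intro hkG
    obtain ⟨hk, h0, hne⟩ := mem_cut.1 hkG
    refine ⟨hk, h0, ?_⟩
    by_contra hge
    have := hmono (not_lt.1 hge)
    simp only [Function.comp_apply, Equiv.apply_symm_apply, OrderDual.toDual_le_toDual] at this
    exact hne (le_antisymm this (hG (hpred k hk)))

theorem coeff_descSum {n p : ℕ} (S : Finset ℕ) (σ : Equiv.Perm (Fin n)) :
    (descSum n p S).coeff σ = if descSet σ ⊆ (S : Set ℕ) then 1 else 0 := by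
  simp [descSum, MonoidAlgebra.of_apply, MonoidAlgebra.coeff_sum, Finsupp.single_apply]

theorem descSum_notMem_Ysub {n : ℕ} {S : Finset ℕ} (hS : S ⊆ Finset.Ico 1 n) :
    descSum n 2 S ∉ Ysub n 2 (S.card + 2) := by
  choose! σ hσ using fun (R : Finset ℕ) (h : R ⊆ Finset.Ico 1 n) => exists_descSet_eq h
  let φ : GroupAlg n 2 →ₗ[ZMod 2] ZMod 2 :=
    { toFun := fun x => ∑ R ∈ Finset.Icc S (Finset.Ico 1 n), x.coeff (σ R)
      map_add' := fun x y => by simp [Finset.sum_add_distrib]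
      map_smul' := fun r x => by simp [Finset.mul_sum] }
  have hφ : ∀ Q ⊆ Finset.Ico 1 n, φ (descSum n 2 Q) = ((Finset.Icc S Q).card : ZMod 2) := by
    intro Q hQ
    change ∑ R ∈ Finset.Icc S (Finset.Ico 1 n), (descSum n 2 Q).coeff (σ R) = _
    have hcoeff : ∀ R ∈ Finset.Icc S (Finset.Ico 1 n),
        (descSum n 2 Q).coeff (σ R) = if R ⊆ Q then 1 else 0 := fun R hR => by
      rw [coeff_descSum, hσ R (Finset.mem_Icc.1 hR).2]
      exact if_congr Finset.coe_subset rfl rfl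
    rw [Finset.sum_congr rfl hcoeff, Finset.sum_boole]
    congr 2
    ext R
    simp only [Finset.mem_filter, Finset.mem_Icc]
    exact ⟨fun h => ⟨h.1.1, h.2⟩, fun h => ⟨⟨h.1, h.2.trans hQ⟩, h.2⟩⟩
  have hker : Ysub n 2 (S.card + 2) ≤ LinearMap.ker φ := by
    refine Submodule.span_le.2 ?_
    rintro x ⟨q, hq, rfl⟩
    rw [SetLike.mem_coe, LinearMap.mem_ker, Bel_eq_descSum, hφ _ (breaks_subset_Ico q)]
    by_cases hSq : S ⊆ breaks q
    · rw [Finset.card_Icc_finset hSq, card_breaks, Nat.cast_pow]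
      have : ((2 : ℕ) : ZMod 2) = 0 := rfl
      rw [this, zero_pow (by omega)]
    · rw [Finset.Icc_eq_empty (by simpa using hSq)]
      simp
  intro hmem
  have := hker hmem
  rw [LinearMap.mem_ker, hφ S hS] at this
  simp at this

theorem mul_mem_Ysub {n p m : ℕ} (hn : 1 ≤ n) {x y : GroupAlg n p} (hx : x ∈ descentAlgebra n p)
    (hy : y ∈ Ysub n p m) : x * y ∈ Ysub n p m := by
  induction hy using Submodule.span_induction with
  | mem y hy =>
    obtain ⟨q, hq, rfl⟩ := hy
    have hx' := descentAlgebra_le_descSpan n p hx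
    rw [Bel_eq_descSum]
    clear hx
    rw [descSpan] at hx'
    induction hx' using Submodule.span_induction with
    | mem x hx =>
      obtain ⟨R, hR, rfl⟩ := hx
      refine descSum_mul_descSum_mem hR (breaks_subset_Ico q) fun Q hQ hle =>
        descSum_mem_Ysub p hQ hn ?_
      have := Finset.card_le_card hle
      rw [card_breaks] at this
      omega
    | zero => simp
    | add a b _ _ ha hb => rw [add_mul]; exact Submodule.add_mem _ ha hb
    | smul r a _ ha => rw [smul_mul_assoc]; exact Submodule.smul_mem _ _ ha
  | zero => simp
  | add a b _ _ ha hb => rw [mul_add]; exact Submodule.add_mem _ ha hb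
  | smul r a _ ha => rw [mul_smul_comm]; exact Submodule.smul_mem _ _ ha

/-- The words constant on the intervals cut out by `S` contribute the leading term. -/
theorem sum_weight_sub_mem {n p : ℕ} (hn : 1 ≤ n) (X : (Fin n → Fin n) → ZMod p) {S : Finset ℕ}
    (hS : S ⊆ Finset.Ico 1 n) :
    (∑ K ∈ Finset.univ.filter (fun K : Fin n → Fin n => wordDes K ⊆ (S : Set ℕ)),
        X K • descSum n p (S ∪ cut K)) -
      (∑ K ∈ Finset.univ.filter (fun K : Fin n → Fin n => cut K ⊆ S), X K) • descSum n p S ∈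
      Ysub n p (S.card + 2) := by
  have hsplit := Finset.sum_filter_add_sum_filter_not
    (Finset.univ.filter (fun K : Fin n → Fin n => wordDes K ⊆ (S : Set ℕ)))
    (fun K => cut K ⊆ S) (fun K => X K • descSum n p (S ∪ cut K))
  have hlead : (Finset.univ.filter (fun K : Fin n → Fin n => wordDes K ⊆ (S : Set ℕ))).filter
      (fun K => cut K ⊆ S) = Finset.univ.filter (fun K : Fin n → Fin n => cut K ⊆ S) := by
    ext K
    simp only [Finset.mem_filter, Finset.mem_univ, true_and, and_iff_right_iff_imp]
    exact fun h => (wordDes_subset_cut K).trans (by exact_mod_cast h)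
  rw [hlead] at hsplit
  rw [← hsplit, Finset.sum_smul, add_sub_right_comm, ← Finset.sum_sub_distrib,
    Finset.sum_eq_zero, zero_add]
  · refine Submodule.sum_mem _ fun K hK => Submodule.smul_mem _ _ ?_
    have hK' : ¬ cut K ⊆ S := (Finset.mem_filter.1 hK).2
    refine descSum_mem_Ysub p (Finset.union_subset hS (cut_subset_Ico K)) hn ?_
    have : S.card < (S ∪ cut K).card := Finset.card_lt_card
      ⟨Finset.subset_union_left, fun h => hK' (Finset.subset_union_right.trans h)⟩
    omega
  · intro K hK
    rw [Finset.union_eq_left.2 (Finset.mem_filter.1 hK).2, sub_self]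

theorem sum_weight_eq_zero {n : ℕ} (hn : 1 ≤ n) {x : descentAlgebra n 2}
    (hx : x ∈ descentRadical n 2) {X : (Fin n → Fin n) → ZMod 2}
    (hX : ∀ S : Finset ℕ, (x : GroupAlg n 2) * descSum n 2 S =
      ∑ K ∈ Finset.univ.filter (fun K : Fin n → Fin n => wordDes K ⊆ (S : Set ℕ)),
        X K • descSum n 2 (S ∪ cut K)) {S : Finset ℕ} (hS : S ⊆ Finset.Ico 1 n) :
    ∑ K ∈ Finset.univ.filter (fun K : Fin n → Fin n => cut K ⊆ S), X K = 0 := by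
  by_contra hne
  have hone : ∑ K ∈ Finset.univ.filter (fun K : Fin n → Fin n => cut K ⊆ S), X K = 1 :=
    Fin.eq_one_of_ne_zero _ hne
  have hsub := sum_weight_sub_mem hn X hS
  rw [← hX, hone, one_smul] at hsub
  obtain ⟨u, hu⟩ := Ideal.exists_mul_add_sub_mem_of_mem_jacobson x hx
  rw [Ideal.mem_bot, sub_eq_zero] at hu
  have hu' : (u : GroupAlg n 2) * (x + 1) = 1 := by exact_mod_cast congrArg Subtype.val hu
  apply descSum_notMem_Ysub hS
  rw [← one_mul (descSum n 2 S), ← hu', mul_assoc, add_mul, one_mul]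
  refine mul_mem_Ysub hn u.2 ?_
  convert hsub using 1
  rw [sub_eq_add_neg, ← neg_one_smul (ZMod 2) (descSum n 2 S)]
  simp [show (-1 : ZMod 2) = 1 from rfl]

/-- The rotation of positions exchanging an initial interval of length `d` with the remaining
interval of length `c`. -/
def blockRotation {n c d : ℕ} (h : c + d = n) : Equiv.Perm (Fin n) where
  toFun i := if hi : (i : ℕ) < d then ⟨i + c, by omega⟩ else ⟨i - d, by omega⟩
  invFun i := if hi : (i : ℕ) < c then ⟨i + d, by omega⟩ else ⟨i - c, by omega⟩
  left_inv i := by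
    ext
    by_cases hi : (i : ℕ) < d
    · simp [hi]
    · simp only [hi, dite_false]
      rw [dif_pos (by omega)]
      simp only
      omega
  right_inv i := by
    ext
    by_cases hi : (i : ℕ) < c
    · simp [hi]
    · simp only [hi, dite_false]
      rw [dif_pos (by omega)]
      simp only
      omega

theorem blockRotation_of_lt {n c d : ℕ} (h : c + d = n) {i : ℕ} (hi : i < d) :
    blockRotation h ⟨i, by omega⟩ = ⟨i + c, by omega⟩ := dif_pos hi

theorem blockRotation_of_le {n c d : ℕ} (h : c + d = n) {i : ℕ} (hi : d ≤ i) (hn : i < n) :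
    blockRotation h ⟨i, hn⟩ = ⟨i - d, by omega⟩ := dif_neg (not_lt.2 hi)

theorem comp_blockRotation_blockRotation {n c d : ℕ} (h : c + d = n) (K : Fin n → Fin n) :
    (K ∘ blockRotation h) ∘ blockRotation ((add_comm d c).trans h) = K :=
  funext fun i => congrArg K ((blockRotation h).apply_symm_apply i)

theorem blockRotation_consecutive {n c d : ℕ} (h : c + d = n) {k : ℕ} (hk0 : 0 < k) (hk : k < n)
    (hkd : k ≠ d) : ∃ (l : ℕ) (hl0 : 0 < l) (hl : l < n), l ≠ c ∧
      (l = if k < d then k + c else k - d) ∧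
      blockRotation h ⟨k, hk⟩ = ⟨l, hl⟩ ∧ blockRotation h ⟨k - 1, by omega⟩ = ⟨l - 1, by omega⟩ := by
  rcases lt_or_gt_of_ne hkd with hlt | hgt
  · refine ⟨k + c, by omega, by omega, by omega, by simp [hlt], blockRotation_of_lt h hlt, ?_⟩
    rw [blockRotation_of_lt h (by omega), Fin.mk.injEq]
    omega
  · refine ⟨k - d, by omega, by omega, by omega, by simp [hgt.not_gt],
      blockRotation_of_le h hgt.le hk, ?_⟩
    rw [blockRotation_of_le h (by omega), Fin.mk.injEq]
    omega

theorem mem_cut_comp_blockRotation {n c d : ℕ} (h : c + d = n) (K : Fin n → Fin n) {k : ℕ}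
    (hk0 : 0 < k) (hk : k < n) (hkd : k ≠ d) :
    k ∈ cut (K ∘ blockRotation h) ↔ (if k < d then k + c else k - d) ∈ cut K := by
  obtain ⟨l, hl0, hl, -, hlk, h1, h2⟩ := blockRotation_consecutive h hk0 hk hkd
  rw [← hlk, mem_cut, mem_cut]
  simp only [Function.comp_apply, h1, h2, hk, hl, hk0, hl0, true_and, exists_true_left]

theorem mem_wordDes_comp_blockRotation {n c d : ℕ} (h : c + d = n) (K : Fin n → Fin n) {k : ℕ}
    (hk0 : 0 < k) (hk : k < n) (hkd : k ≠ d) :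
    k ∈ wordDes (K ∘ blockRotation h) ↔ (if k < d then k + c else k - d) ∈ wordDes K := by
  obtain ⟨l, hl0, hl, -, hlk, h1, h2⟩ := blockRotation_consecutive h hk0 hk hkd
  rw [← hlk, mem_wordDes, mem_wordDes]
  simp only [Function.comp_apply, h1, h2, hk, hl, hk0, hl0, true_and, exists_true_left]

theorem wordDes_subset_and_cut_eq_iff {n c e : ℕ}
    (he : e ∈ Finset.Ico 1 n) (K : Fin n → Fin n) :
    (wordDes K ⊆ (({c} : Finset ℕ) : Set ℕ) ∧ {c} ∪ cut K = {c, e}) ↔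
      ∀ k, 0 < k → k < n → k ≠ c → k ∉ wordDes K ∧ (k ∈ cut K ↔ k = e) := by
  constructor
  · rintro ⟨h1, h2⟩ k - - hkc
    refine ⟨fun hk => hkc (by simpa using h1 hk), ?_⟩
    have := congrArg (k ∈ ·) h2
    simpa [hkc] using this
  · intro h
    constructor
    · intro k hk
      by_contra hkc
      obtain ⟨hkn, hk0, -⟩ := id hk
      exact (h k hk0 hkn (by simpa using hkc)).1 hk
    · ext k
      by_cases hkc : k = c
      · simp [hkc]
      · simp only [Finset.mem_union, Finset.mem_singleton, hkc, false_or, Finset.mem_insert]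
        constructor
        · intro hk
          have := Finset.mem_Ico.1 (cut_subset_Ico K hk)
          exact (h k this.1 this.2 hkc).2.1 hk
        · rintro rfl
          have := Finset.mem_Ico.1 he
          exact (h k this.1 this.2 hkc).2.2 rfl

theorem comp_blockRotation_of_cut_eq_pair {n c d e : ℕ} (h : c + d = n) (hc : 0 < c) (hd : 0 < d)
    (he0 : 0 < e) (hen : e < n) (hec : e ≠ c) {K : Fin n → Fin n}
    (hK : wordDes K ⊆ (({c} : Finset ℕ) : Set ℕ) ∧ {c} ∪ cut K = {c, e}) :
    wordDes (K ∘ blockRotation h) ⊆ (({d} : Finset ℕ) : Set ℕ) ∧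
      {d} ∪ cut (K ∘ blockRotation h) = {d, if e < c then e + d else e - c} := by
  rw [wordDes_subset_and_cut_eq_iff (by simp; omega)] at hK
  rw [wordDes_subset_and_cut_eq_iff (by simp; split_ifs <;> omega)]
  intro k hk0 hk hkd
  rw [mem_cut_comp_blockRotation h K hk0 hk hkd, mem_wordDes_comp_blockRotation h K hk0 hk hkd]
  obtain ⟨h1, h2⟩ := hK (if k < d then k + c else k - d) (by split_ifs <;> omega)
    (by split_ifs <;> omega) (by split_ifs <;> omega)
  refine ⟨h1, h2.trans ?_⟩
  split_ifs <;> omega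

/-- The total weight of the words which refine the cut `c` by the cut `e`. -/
def pairWeight {n : ℕ} (X : (Fin n → Fin n) → ZMod 2) (c e : ℕ) : ZMod 2 :=
  ∑ K ∈ Finset.univ.filter (fun K : Fin n → Fin n =>
    wordDes K ⊆ (({c} : Finset ℕ) : Set ℕ) ∧ {c} ∪ cut K = {c, e}), X K

theorem pairWeight_blockRotation {n c d e : ℕ} (h : c + d = n) (hd : 0 < d) (he0 : 0 < e)
    (hec : e < c)
    {X : (Fin n → Fin n) → ZMod 2} (hX : ∀ K (π : Equiv.Perm (Fin n)), X (K ∘ π) = X K) :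
    pairWeight X c e = pairWeight X d (e + d) := by
  have h' : d + c = n := by omega
  refine Finset.sum_bij' (fun K _ => K ∘ blockRotation h) (fun K _ => K ∘ blockRotation h')
    ?_ ?_ ?_ ?_ ?_
  · intro K hK
    rw [Finset.mem_filter] at hK ⊢
    have := comp_blockRotation_of_cut_eq_pair h (by omega) hd he0 (by omega) (by omega) hK.2
    rw [if_pos hec] at this
    exact ⟨Finset.mem_univ _, this⟩
  · intro K hK
    rw [Finset.mem_filter] at hK ⊢
    have := comp_blockRotation_of_cut_eq_pair h' hd (by omega) (by omega) (by omega) (by omega) hK.2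
    rw [if_neg (by omega), Nat.add_sub_cancel] at this
    exact ⟨Finset.mem_univ _, this⟩
  · exact fun K _ => comp_blockRotation_blockRotation h K
  · exact fun K _ => comp_blockRotation_blockRotation h' K
  · exact fun K _ => (hX K _).symm

theorem descSum_pair_eq_Bel {n : ℕ} (p : ℕ) {a b c : ℕ} (ha : 0 < a) (hb : 0 < b) (hc : 0 < c)
    (h : a + b + c = n) : ∃ q : Composition n, q.blocks = [a, b, c] ∧
      descSum n p {a, a + b} = Bel n p q := by
  refine ⟨⟨[a, b, c], ?_, by simp; omega⟩, rfl, ?_⟩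
  · intro i hi
    simp only [List.mem_cons, List.not_mem_nil, or_false] at hi
    rcases hi with rfl | rfl | rfl <;> assumption
  · rw [Bel_eq_descSum]
    congr 1
    have : Finset.Ioo 0 3 = {1, 2} := rfl
    simp [breaks, Composition.length, Composition.sizeUpTo, this]

theorem descSum_pair_add_blockRotation_mem {n c d e : ℕ} (h : c + d = n) (hd : 0 < d) (he0 : 0 < e)
    (hec : e < c) :
    descSum n 2 {c, e} + descSum n 2 {d, e + d} ∈ Ysub n 2 3 ⊓ Tsub n 2 := by
  obtain ⟨q, hq, hq'⟩ := descSum_pair_eq_Bel (n := n) 2 he0 (b := c - e) (by omega) hd (by omega)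
  obtain ⟨r, hr, hr'⟩ := descSum_pair_eq_Bel (n := n) 2 hd he0 (c := c - e) (by omega) (by omega)
  rw [show ({c, e} : Finset ℕ) = {e, e + (c - e)} by
    rw [Finset.pair_comm]; congr; omega, hq', add_comm e d, hr']
  constructor
  · refine Submodule.add_mem _ ?_ ?_
    · exact Submodule.subset_span ⟨q, by simp [Composition.length, hq], rfl⟩
    · exact Submodule.subset_span ⟨r, by simp [Composition.length, hr], rfl⟩
  · refine Submodule.subset_span ⟨q, r, ?_, ?_⟩
    · rw [hq, hr]
      exact List.perm_append_comm (l₁ := [e, c - e]) (l₂ := [d])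
    · rw [sub_eq_add_neg, ← neg_one_smul (ZMod 2) (Bel n 2 r), show (-1 : ZMod 2) = 1 from rfl,
        one_smul]

theorem eq_of_cut_subset_singleton {n c : ℕ} {K : Fin n → Fin n} (hK : cut K ⊆ {c})
    {i j : Fin n} (hij : i ≤ j) (h : (j : ℕ) < c ∨ c ≤ i) : K i = K j := by
  rcases hij.lt_or_eq with hlt | rfl
  · refine rel_of_forall_consecutive (· = ·) (fun _ _ _ => Eq.trans) K hlt fun k hk h1 h2 => ?_
    by_contra hne
    have := Finset.mem_singleton.1 (hK (mem_cut.2 ⟨hk, by omega, fun he => hne he.symm⟩))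
    omega
  · rfl

theorem cut_comp_blockRotation {n c d : ℕ} (h : c + d = n) (hc : 0 < c) (hd : 0 < d)
    {K : Fin n → Fin n} (hK : cut K = {c}) :
    cut (K ∘ blockRotation h) = {d} ∧
      (wordDes (K ∘ blockRotation h) ⊆ ∅ ↔ ¬ wordDes K ⊆ ∅) := by
  have hdrot : blockRotation h ⟨d, by omega⟩ = ⟨0, by omega⟩ := by
    rw [blockRotation_of_le h le_rfl (by omega), Fin.mk.injEq]
    omega
  have hdrot' : blockRotation h ⟨d - 1, by omega⟩ = ⟨n - 1, by omega⟩ := by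
    rw [blockRotation_of_lt h (by omega), Fin.mk.injEq]
    omega
  have hfst : K ⟨0, by omega⟩ = K ⟨c - 1, by omega⟩ :=
    eq_of_cut_subset_singleton hK.subset (by simp) (Or.inl (by simp; omega))
  have hsnd : K ⟨c, by omega⟩ = K ⟨n - 1, by omega⟩ :=
    eq_of_cut_subset_singleton hK.subset (by simp; omega) (Or.inr (by simp))
  obtain ⟨hcn, -, hne⟩ := mem_cut.1 (hK ▸ Finset.mem_singleton_self c)
  have hcut : cut (K ∘ blockRotation h) = {d} := by
    ext k
    rw [Finset.mem_singleton]
    by_cases hkd : k = d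
    · subst hkd
      simp only [iff_true, mem_cut, Function.comp_apply, hdrot, hdrot', hfst, ← hsnd]
      exact ⟨by omega, hd, hne.symm⟩
    · simp only [hkd, iff_false]
      intro hk
      have hkn := Finset.mem_Ico.1 (cut_subset_Ico _ hk)
      rw [mem_cut_comp_blockRotation h K hkn.1 hkn.2 hkd, hK, Finset.mem_singleton] at hk
      split_ifs at hk <;> omega
  have hdes : ∀ {L : Fin n → Fin n} {e : ℕ}, cut L = {e} → (wordDes L ⊆ ∅ ↔ e ∉ wordDes L) := by
    intro L e hL
    refine ⟨fun h he => h he, fun h k hk => h ?_⟩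
    have := wordDes_subset_cut L hk
    rw [hL, Finset.coe_singleton, Set.mem_singleton_iff] at this
    rwa [← this]
  refine ⟨hcut, ?_⟩
  rw [hdes hcut, hdes hK, not_not, mem_wordDes, mem_wordDes]
  simp only [Function.comp_apply, hdrot, hdrot', hfst, ← hsnd]
  constructor
  · intro hn
    by_contra hn'
    push Not at hn'
    exact hn ⟨by omega, hd, lt_of_le_of_ne (hn' hcn hc) hne.symm⟩
  · rintro ⟨_, _, hlt⟩ ⟨_, _, hlt'⟩
    exact lt_asymm hlt hlt'

/-- The total weight of the monotone words with a single cut at `c`. -/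
def cutWeight {n : ℕ} (Y : (Fin n → Fin n) → ZMod 2) (c : ℕ) : ZMod 2 :=
  ∑ K ∈ Finset.univ.filter (fun K : Fin n → Fin n => cut K = {c} ∧ wordDes K ⊆ ∅), Y K

theorem cutWeight_eq_of_add_eq {n c d : ℕ} (h : c + d = n) (hc : 0 < c) (hd : 0 < d)
    {Y : (Fin n → Fin n) → ZMod 2} (hY : ∀ K (π : Equiv.Perm (Fin n)), Y (K ∘ π) = Y K)
    (hY0 : ∑ K ∈ Finset.univ.filter (fun K : Fin n → Fin n => cut K ⊆ ∅), Y K = 0)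
    (hYc : ∑ K ∈ Finset.univ.filter (fun K : Fin n → Fin n => cut K ⊆ {c}), Y K = 0) :
    cutWeight Y c = cutWeight Y d := by
  have h' : d + c = n := by omega
  have hrot : ∑ K ∈ Finset.univ.filter (fun K : Fin n → Fin n => cut K = {c} ∧ ¬ wordDes K ⊆ ∅), Y K
      = cutWeight Y d := by
    refine Finset.sum_bij' (fun K _ => K ∘ blockRotation h) (fun K _ => K ∘ blockRotation h')
      ?_ ?_ ?_ ?_ ?_
    · intro K hK
      rw [Finset.mem_filter] at hK ⊢
      have := cut_comp_blockRotation h hc hd hK.2.1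
      exact ⟨Finset.mem_univ _, this.1, this.2.2 hK.2.2⟩
    · intro K hK
      rw [Finset.mem_filter] at hK ⊢
      have := cut_comp_blockRotation h' hd hc hK.2.1
      exact ⟨Finset.mem_univ _, this.1, fun hn => this.2.1 hn hK.2.2⟩
    · exact fun K _ => comp_blockRotation_blockRotation h K
    · exact fun K _ => comp_blockRotation_blockRotation h' K
    · exact fun K _ => (hY K _).symm
  have hpt : ∀ K : Fin n → Fin n, (if cut K ⊆ {c} then Y K else 0) =
      (if cut K ⊆ ∅ then Y K else 0) + (if cut K = {c} ∧ wordDes K ⊆ ∅ then Y K else 0) +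
        (if cut K = {c} ∧ ¬ wordDes K ⊆ ∅ then Y K else 0) := by
    intro K
    by_cases h0 : cut K = ∅
    · simp [h0]
    · by_cases h1 : cut K = {c}
      · by_cases h2 : wordDes K ⊆ ∅ <;> simp [h1, h2]
      · have : ¬ cut K ⊆ {c} := by
          rw [Finset.subset_singleton_iff]
          tauto
        simp [h0, h1, this]
  rw [Finset.sum_filter, Finset.sum_congr rfl fun K _ => hpt K, Finset.sum_add_distrib,
    Finset.sum_add_distrib, ← Finset.sum_filter, ← Finset.sum_filter, ← Finset.sum_filter, hY0,
    hrot, zero_add] at hYc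
  exact CharTwo.add_eq_zero.1 hYc

theorem mul_descSum_singleton_sub_mem {n c : ℕ} (hn : 1 ≤ n) (hc : c ∈ Finset.Ico 1 n)
    {x : GroupAlg n 2} {X : (Fin n → Fin n) → ZMod 2}
    (hX : ∀ S : Finset ℕ, x * descSum n 2 S =
      ∑ K ∈ Finset.univ.filter (fun K : Fin n → Fin n => wordDes K ⊆ (S : Set ℕ)),
        X K • descSum n 2 (S ∪ cut K))
    (hXc : ∑ K ∈ Finset.univ.filter (fun K : Fin n → Fin n => cut K ⊆ {c}), X K = 0) :
    x * descSum n 2 {c} - ∑ e ∈ (Finset.Ico 1 n).erase c, pairWeight X c e • descSum n 2 {c, e} ∈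
      Ysub n 2 4 := by
  have hlead : ∑ K ∈ Finset.univ.filter (fun K : Fin n → Fin n =>
      wordDes K ⊆ (({c} : Finset ℕ) : Set ℕ)),
      (if cut K ⊆ {c} then X K • descSum n 2 {c} else 0) = 0 := by
    rw [← Finset.sum_filter, Finset.filter_filter, ← Finset.sum_smul]
    convert zero_smul (ZMod 2) (descSum n 2 {c})
    rw [← hXc]
    refine Finset.sum_congr (Finset.filter_congr fun K _ => ?_) fun _ _ => rfl
    exact and_iff_right_of_imp fun h => (wordDes_subset_cut K).trans (by exact_mod_cast h)
  have hpair : ∑ e ∈ (Finset.Ico 1 n).erase c, pairWeight X c e • descSum n 2 {c, e} =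
      ∑ K ∈ Finset.univ.filter (fun K : Fin n → Fin n =>
        wordDes K ⊆ (({c} : Finset ℕ) : Set ℕ)), ∑ e ∈ (Finset.Ico 1 n).erase c,
          if {c} ∪ cut K = {c, e} then X K • descSum n 2 {c, e} else 0 := by
    rw [Finset.sum_comm]
    refine Finset.sum_congr rfl fun e _ => ?_
    rw [pairWeight, Finset.sum_smul, ← Finset.sum_filter, Finset.filter_filter]
  have hdiff : x * descSum n 2 {c} -
      ∑ e ∈ (Finset.Ico 1 n).erase c, pairWeight X c e • descSum n 2 {c, e} =
      ∑ K ∈ Finset.univ.filter (fun K : Fin n → Fin n =>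
        wordDes K ⊆ (({c} : Finset ℕ) : Set ℕ)), (X K • descSum n 2 ({c} ∪ cut K) -
          (if cut K ⊆ {c} then X K • descSum n 2 {c} else 0) - ∑ e ∈ (Finset.Ico 1 n).erase c,
            if {c} ∪ cut K = {c, e} then X K • descSum n 2 {c, e} else 0) := by
    rw [Finset.sum_sub_distrib, Finset.sum_sub_distrib, hlead, sub_zero, hX, hpair]
  rw [hdiff]
  refine Submodule.sum_mem _ fun K _ => ?_
  by_cases h1 : cut K ⊆ {c}
  · rw [if_pos h1, Finset.union_eq_left.2 h1, sub_self, zero_sub, Finset.sum_eq_zero, neg_zero]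
    · exact Submodule.zero_mem _
    · intro e he
      refine if_neg fun h => (Finset.mem_erase.1 he).1 ?_
      have : e ∈ ({c, e} : Finset ℕ) := by simp
      rw [← h] at this
      simpa using this
  rw [if_neg h1, sub_zero]
  by_cases h2 : ∃ e ∈ (Finset.Ico 1 n).erase c, {c} ∪ cut K = {c, e}
  · obtain ⟨e, he, hce⟩ := h2
    rw [Finset.sum_eq_single_of_mem e he, if_pos hce, hce, sub_self]
    · exact Submodule.zero_mem _
    · intro f hf hfe
      refine if_neg fun h => ?_
      have : f ∈ ({c, f} : Finset ℕ) := by simp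
      rw [← h, hce] at this
      simp only [Finset.mem_insert, Finset.mem_singleton] at this
      exact this.elim (Finset.mem_erase.1 hf).1 hfe
  · rw [Finset.sum_eq_zero fun e he => if_neg fun h => h2 ⟨e, he, h⟩, sub_zero]
    have hsub : {c} ∪ cut K ⊆ Finset.Ico 1 n :=
      Finset.union_subset (Finset.singleton_subset_iff.2 hc) (cut_subset_Ico K)
    refine Submodule.smul_mem _ _ (descSum_mem_Ysub 2 hsub hn ?_)
    by_contra hcard
    obtain ⟨e, he, hec⟩ : ∃ e ∈ cut K, e ≠ c := by
      by_contra hcon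
      push Not at hcon
      exact h1 fun e he => Finset.mem_singleton.2 (hcon e he)
    refine h2 ⟨e, Finset.mem_erase.2 ⟨hec, cut_subset_Ico K he⟩, ?_⟩
    refine (Finset.eq_of_subset_of_card_le ?_ ?_).symm
    · intro k hk
      simp only [Finset.mem_insert, Finset.mem_singleton] at hk
      rcases hk with rfl | rfl <;> simp [he]
    · rw [Finset.card_pair hec.symm]
      omega

theorem mul_sub_sum_cutWeight_mem {n : ℕ} {x y : GroupAlg n 2}
    (hx : ∀ S ⊆ Finset.Ico 1 n, x * descSum n 2 S ∈ Ysub n 2 (S.card + 2))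
    {Y : (Fin n → Fin n) → ZMod 2}
    (hY : ∀ S : Finset ℕ, y * descSum n 2 S =
      ∑ K ∈ Finset.univ.filter (fun K : Fin n → Fin n => wordDes K ⊆ (S : Set ℕ)),
        Y K • descSum n 2 (S ∪ cut K))
    (hY0 : ∑ K ∈ Finset.univ.filter (fun K : Fin n → Fin n => cut K ⊆ ∅), Y K = 0) :
    x * y - ∑ c ∈ Finset.Ico 1 n, cutWeight Y c • (x * descSum n 2 {c}) ∈ Ysub n 2 4 := by
  have hy := hY ∅
  rw [descSum_empty, mul_one] at hy
  simp only [Finset.empty_union, Finset.coe_empty] at hy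
  have hlead : ∑ K ∈ Finset.univ.filter (fun K : Fin n → Fin n => wordDes K ⊆ ∅),
      (if cut K ⊆ ∅ then Y K • x else 0) = 0 := by
    rw [← Finset.sum_filter, Finset.filter_filter, ← Finset.sum_smul]
    convert zero_smul (ZMod 2) x
    rw [← hY0]
    refine Finset.sum_congr (Finset.filter_congr fun K _ => ?_) fun _ _ => rfl
    refine and_iff_right_of_imp fun h => (wordDes_subset_cut K).trans ?_
    rw [← Finset.coe_empty]
    exact_mod_cast h
  have hsingle : ∑ c ∈ Finset.Ico 1 n, cutWeight Y c • (x * descSum n 2 {c}) =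
      ∑ K ∈ Finset.univ.filter (fun K : Fin n → Fin n => wordDes K ⊆ ∅),
        ∑ c ∈ Finset.Ico 1 n, if cut K = {c} then Y K • (x * descSum n 2 {c}) else 0 := by
    rw [Finset.sum_comm]
    refine Finset.sum_congr rfl fun e _ => ?_
    rw [cutWeight, Finset.sum_smul, ← Finset.sum_filter, Finset.filter_filter]
    exact Finset.sum_congr (Finset.filter_congr fun K _ => and_comm) fun _ _ => rfl
  have hdiff : x * y - ∑ c ∈ Finset.Ico 1 n, cutWeight Y c • (x * descSum n 2 {c}) =
      ∑ K ∈ Finset.univ.filter (fun K : Fin n → Fin n => wordDes K ⊆ ∅),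
        (x * Y K • descSum n 2 (cut K) - (if cut K ⊆ ∅ then Y K • x else 0) -
          ∑ c ∈ Finset.Ico 1 n, if cut K = {c} then Y K • (x * descSum n 2 {c}) else 0) := by
    rw [Finset.sum_sub_distrib, Finset.sum_sub_distrib, hlead, sub_zero, hy, Finset.mul_sum,
      hsingle]
  rw [hdiff]
  refine Submodule.sum_mem _ fun K _ => ?_
  rw [mul_smul_comm]
  by_cases h1 : cut K ⊆ ∅
  · have h1' : cut K = ∅ := Finset.subset_empty.1 h1
    rw [if_pos h1, h1', descSum_empty, mul_one, sub_self, zero_sub, Finset.sum_eq_zero, neg_zero]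
    · exact Submodule.zero_mem _
    · exact fun e _ => if_neg (Finset.singleton_ne_empty e).symm
  rw [if_neg h1, sub_zero]
  by_cases h2 : ∃ c ∈ Finset.Ico 1 n, cut K = {c}
  · obtain ⟨c, hc, hce⟩ := h2
    rw [Finset.sum_eq_single_of_mem c hc, if_pos hce, hce, sub_self]
    · exact Submodule.zero_mem _
    · intro f _ hfe
      refine if_neg fun h => hfe ?_
      rw [hce, Finset.singleton_inj] at h
      exact h.symm
  · rw [Finset.sum_eq_zero fun e he => if_neg fun h => h2 ⟨e, he, h⟩, sub_zero]
    refine Submodule.smul_mem _ _ ?_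
    have hcard : 2 ≤ (cut K).card := by
      have h0 : (cut K).card ≠ 0 := fun h => h1 (Finset.card_eq_zero.1 h).subset
      have h1 : (cut K).card ≠ 1 := fun h => by
        obtain ⟨c, hc⟩ := Finset.card_eq_one.1 h
        exact h2 ⟨c, cut_subset_Ico K (hc ▸ Finset.mem_singleton_self c), hc⟩
      omega
    refine Submodule.span_mono ?_ (hx _ (cut_subset_Ico K))
    rintro z ⟨q, hq, rfl⟩
    exact ⟨q, by omega, rfl⟩

theorem mul_mem_of_mem_descentRadical {n : ℕ} (hn : 1 ≤ n) {x y : descentAlgebra n 2}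
    (hx : x ∈ descentRadical n 2) (hy : y ∈ descentRadical n 2) :
    (x * y : GroupAlg n 2) ∈ (Ysub n 2 3 ⊓ Tsub n 2) ⊔ Ysub n 2 4 := by
  obtain ⟨X, hXinv, hX⟩ := exists_weight x.2
  obtain ⟨Y, hYinv, hY⟩ := exists_weight y.2
  have hX0 := fun S (hS : S ⊆ Finset.Ico 1 n) => sum_weight_eq_zero hn hx hX hS
  have hY0 := fun S (hS : S ⊆ Finset.Ico 1 n) => sum_weight_eq_zero hn hy hY hS
  have hxS : ∀ S ⊆ Finset.Ico 1 n, (x : GroupAlg n 2) * descSum n 2 S ∈ Ysub n 2 (S.card + 2) := by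
    intro S hS
    have := sum_weight_sub_mem hn X hS
    rwa [← hX, hX0 S hS, zero_smul, sub_zero] at this
  have hsum := mul_sub_sum_cutWeight_mem hxS hY (hY0 ∅ (Finset.empty_subset _))
  let f : ℕ → ℕ → GroupAlg n 2 := fun c e => pairWeight X c e • descSum n 2 {c, e}
  have hc4 : ∑ c ∈ Finset.Ico 1 n, cutWeight Y c • ((x : GroupAlg n 2) * descSum n 2 {c}) -
      ∑ c ∈ Finset.Ico 1 n, cutWeight Y c • ∑ e ∈ (Finset.Ico 1 n).erase c, f c e ∈
      Ysub n 2 4 := by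
    rw [← Finset.sum_sub_distrib]
    refine Submodule.sum_mem _ fun c hc => ?_
    rw [← smul_sub]
    exact Submodule.smul_mem _ _
      (mul_descSum_singleton_sub_mem hn hc hX (hX0 _ (Finset.singleton_subset_iff.2 hc)))
  have hsplit : ∀ c ∈ Finset.Ico 1 n, ∑ e ∈ (Finset.Ico 1 n).erase c, f c e =
      ∑ e ∈ Finset.Ico 1 c, f c e + ∑ e ∈ Finset.Ico (c + 1) n, f c e := by
    intro c hc
    rw [← Finset.sum_union]
    · refine Finset.sum_congr ?_ fun _ _ => rfl
      ext e
      simp only [Finset.mem_erase, Finset.mem_union, Finset.mem_Ico] at hc ⊢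
      omega
    · refine Finset.disjoint_left.2 fun e he he' => ?_
      rw [Finset.mem_Ico] at he he'
      omega
  have hreflect : ∑ c ∈ Finset.Ico 1 n, cutWeight Y c • ∑ e ∈ Finset.Ico (c + 1) n, f c e =
      ∑ c ∈ Finset.Ico 1 n, cutWeight Y c • ∑ e ∈ Finset.Ico 1 c, f (n - c) (e + (n - c)) := by
    refine Finset.sum_bij' (fun c _ => n - c) (fun c _ => n - c) ?_ ?_ ?_ ?_ ?_
    · intro c hc; rw [Finset.mem_Ico] at hc ⊢; omega
    · intro c hc; rw [Finset.mem_Ico] at hc ⊢; omega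
    · intro c hc; rw [Finset.mem_Ico] at hc; omega
    · intro c hc; rw [Finset.mem_Ico] at hc; omega
    · intro c hc
      have hcn := Finset.mem_Ico.1 hc
      rw [cutWeight_eq_of_add_eq (by omega : c + (n - c) = n) (by omega) (by omega) hYinv
        (hY0 ∅ (Finset.empty_subset _)) (hY0 _ (Finset.singleton_subset_iff.2 hc)),
        show n - (n - c) = c by omega, Finset.sum_Ico_add' (f c) 1 (n - c) c]
      congr 3 <;> omega
  have hmain : ∑ c ∈ Finset.Ico 1 n, cutWeight Y c • ∑ e ∈ (Finset.Ico 1 n).erase c, f c e ∈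
      Ysub n 2 3 ⊓ Tsub n 2 := by
    rw [Finset.sum_congr rfl fun c hc => by rw [hsplit c hc, smul_add], Finset.sum_add_distrib,
      hreflect, ← Finset.sum_add_distrib]
    refine Submodule.sum_mem _ fun c hc => ?_
    rw [← smul_add, ← Finset.sum_add_distrib]
    refine Submodule.smul_mem _ _ (Submodule.sum_mem _ fun e he => ?_)
    rw [Finset.mem_Ico] at hc he
    have hcd : c + (n - c) = n := by omega
    simp only [f]
    rw [← pairWeight_blockRotation hcd (by omega) he.1 he.2 hXinv, ← smul_add]
    exact Submodule.smul_mem _ _ (descSum_pair_add_blockRotation_mem hcd (by omega) he.1 he.2)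
  have htotal := Submodule.add_mem_sup hmain (Submodule.add_mem _ hc4 hsum)
  convert htotal using 1
  abel

/-- If `n` is even and `p = 2`, then `R(n,2)² ⊆ (Y_3 ∩ T) + Y_4`. -/
theorem stmt15 (n : ℕ) (hn : 1 ≤ n) (he : Even n) :
    Submodule.map (descentAlgebra n 2).val.toLinearMap
        ((descentRadical n 2 ^ 2).restrictScalars (ZMod 2)) ≤
      (Ysub n 2 3 ⊓ Tsub n 2) ⊔ Ysub n 2 4 := by
  rintro _ ⟨z, hz, rfl⟩
  have hz' : z ∈ descentRadical n 2 * descentRadical n 2 := by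
    change z ∈ descentRadical n 2 ^ (1 + 1) at hz
    rwa [Submodule.pow_succ, Submodule.pow_one] at hz
  clear hz
  induction hz' using Submodule.smul_induction_on' with
  | smul x hx y hy => exact mul_mem_of_mem_descentRadical hn hx hy
  | add x _ y _ hx hy =>
    rw [map_add]
    exact Submodule.add_mem _ hx hy

end
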